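/- arXiv:2412.12141 — 7 statements merged into one kernel-verified Lean document; each statement's English description precedes it below -/
import Mathlib

section
/- Let n, m be positive integers, let w ∈ 𝒲 be a word, and let α = ε_i − δ_j with i ∈ {1,…,n}, j ∈ {1,…,m}. Suppose i and j′ occur as the k-th and (k+1)-th entries of the one-line notation of sh(w). Then the k-th and (k+1)-th letters of w are D and R respectively, and if p_α(w) denotes the word obtained from w by replacing this occurrence of D, R by R, D, then sh(p_α(w)) = (i j′) ∘ sh(w), the composite of sh(w) with the transposition exchanging i and j′. -/
/-- A Young diagram in the `n × m` rectangle, recorded as its sequence of parts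
`λ_1 ≥ λ_2 ≥ … ≥ λ_n` (indexed from `1`), with `λ_i = 0` for `i = 0` and `i > n`. -/
structure YD (n m : ℕ) where
  part : ℕ → ℕ
  mono : ∀ ⦃i j : ℕ⦄, 1 ≤ i → i ≤ j → part j ≤ part i
  le_m : part 1 ≤ m
  outside : ∀ i, n < i → part i = 0
  at_zero : part 0 = 0

namespace YD

variable {n m : ℕ}

/-- The box `B(ε_i - δ_j)` (row `i` from the top, column `j` from the left)
belongs to the diagram `lam`. -/
def mem (lam : YD n m) (i j : ℕ) : Prop :=
  1 ≤ i ∧ i ≤ n ∧ 1 ≤ j ∧ j ≤ m ∧ j ≤ lam.part (n + 1 - i)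

/-- The dual partition: `λ'_j = #{i ∈ {1,…,n} : λ_i ≥ j}`. -/
def dual (lam : YD n m) (j : ℕ) : ℕ :=
  ((Finset.Icc 1 n).filter (fun i => j ≤ lam.part i)).card

/-- `mu` is obtained from `lam` by adding the box `B(ε_i - δ_j)`. -/
def IsAdd (lam : YD n m) (i j : ℕ) (mu : YD n m) : Prop :=
  ∀ i' j', mu.mem i' j' ↔ (lam.mem i' j' ∨ (i' = i ∧ j' = j))

/-- `mu` is obtained from `lam` by removing the box `B(ε_i - δ_j)`. -/
def IsRemove (lam : YD n m) (i j : ℕ) (mu : YD n m) : Prop :=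
  ∀ i' j', mu.mem i' j' ↔ (lam.mem i' j' ∧ ¬(i' = i ∧ j' = j))

/-- `B(ε_i - δ_j)` is an outer corner of `lam`: it lies in the rectangle, is not a box of
`lam`, and adding it to `lam` yields a Young diagram. -/
def OuterCorner (lam : YD n m) (i j : ℕ) : Prop :=
  1 ≤ i ∧ i ≤ n ∧ 1 ≤ j ∧ j ≤ m ∧ ¬ lam.mem i j ∧ ∃ mu : YD n m, lam.IsAdd i j mu

/-- `B(ε_i - δ_j)` is an inner corner of `lam`: it is a box of `lam` and removing it
from `lam` yields a Young diagram. -/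
def InnerCorner (lam : YD n m) (i j : ℕ) : Prop :=
  lam.mem i j ∧ ∃ mu : YD n m, lam.IsRemove i j mu

/-- `λ^{-r} = (λ_2, …, λ_n, 0)`: delete the bottom (longest) row. -/
def rowDel (lam : YD n m) : YD n m where
  part := fun i => if i = 0 then 0 else lam.part (i + 1)
  mono := by
    intro i j hi hij
    have hi' : i ≠ 0 := by omega
    have hj' : j ≠ 0 := by omega
    simp only [hi', hj', if_neg, ite_false]
    exact lam.mono (by omega) (by omega)
  le_m := by
    simpa using le_trans (lam.mono (by omega) (by omega : (1:ℕ) ≤ 2)) lam.le_m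
  outside := by
    intro i hi
    have : i ≠ 0 := by omega
    simp only [this, ite_false]
    exact lam.outside _ (by omega)
  at_zero := by simp

/-- `λ^{+r} = (m, λ_1, …, λ_{n-1})`: add a full row of length `m` at the bottom. -/
def rowAdd (lam : YD n m) : YD n m where
  part := fun i => if i = 0 ∨ n < i then 0 else if i = 1 then m else lam.part (i - 1)
  mono := by
    intro i j hi hij
    by_cases hj : j = 0 ∨ n < j
    · simp [hj]
    · have hi0 : ¬ (i = 0 ∨ n < i) := by omega
      simp only [hj, hi0, ite_false]
      by_cases hi1 : i = 1
      · subst hi1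
        by_cases hj1 : j = 1
        · simp [hj1]
        · simp only [hj1, ite_false]
          exact le_trans (lam.mono (by omega) (by omega : 1 ≤ j - 1)) lam.le_m
      · have hj1 : j ≠ 1 := by omega
        simp only [hi1, hj1, ite_false]
        exact lam.mono (by omega) (by omega)
  le_m := by
    by_cases hn : n = 0
    · simp [hn]
    · have : ¬ ((1:ℕ) = 0 ∨ n < 1) := by omega
      simp [this, hn]
  outside := by
    intro i hi
    simp [Or.inr hi]
  at_zero := by simp

/-- `λ^{-c} = (λ_1 - 1, …, λ_n - 1)`: delete the first column. -/
def colDel (lam : YD n m) : YD n m where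
  part := fun i => lam.part i - 1
  mono := fun _ _ hi hij => Nat.sub_le_sub_right (lam.mono hi hij) 1
  le_m := le_trans (Nat.sub_le _ _) lam.le_m
  outside := fun i hi => by simp [lam.outside i hi]
  at_zero := by simp [lam.at_zero]

/-- `λ^{+c} = (λ_1 + 1, …, λ_n + 1)`: add a full column of height `n` on the left.
(When `λ_1 = m` this clamps at `m`; the operation is only ever used when `λ_1 < m`,
where the clamping is vacuous.) -/
def colAdd (lam : YD n m) : YD n m where
  part := fun i => if i = 0 ∨ n < i then 0 else min m (lam.part i + 1)
  mono := by
    intro i j hi hij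
    by_cases hj : j = 0 ∨ n < j
    · simp [hj]
    · have hi0 : ¬ (i = 0 ∨ n < i) := by omega
      simp only [hj, hi0, ite_false]
      exact min_le_min le_rfl (by exact Nat.succ_le_succ (lam.mono (by omega) hij))
  le_m := by
    by_cases hn : n = 0
    · simp [hn]
    · have : ¬ ((1:ℕ) = 0 ∨ n < 1) := by omega
      simp [this, hn]
  outside := by intro i hi; simp [Or.inr hi]
  at_zero := by simp

end YD

/-- The letter `R` (a rightward step). -/
def Rl : Bool := true

/-- The letter `D` (a downward step). -/
def Dl : Bool := false

/-- A word: a sequence of length `m + n` in the alphabet `{R, D}` with exactly `m`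
letters `R` (and hence exactly `n` letters `D`). -/
def IsWord (n m : ℕ) (w : List Bool) : Prop :=
  w.length = m + n ∧ w.count Rl = m

/-- `w` is the word `w(λ)` of the Young diagram `λ`: it is a word, and for each
`i ∈ {1,…,n}` the `i`-th occurrence of `D` from the left is preceded by exactly
`λ_{n+1-i}` occurrences of `R`.  (At a position `k` holding a `D`, the number of earlier
`D`'s is `i - 1` and the number of earlier `R`'s must be `λ_{n - (i-1)}`.) -/
def IsWordOf {n m : ℕ} (lam : YD n m) (w : List Bool) : Prop :=
  IsWord n m w ∧
  ∀ k : ℕ, k < w.length → w.getD k Rl = Dl →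
    (w.take k).count Rl = lam.part (n - (w.take k).count Dl)

/-- The index set `I = {1,…,n} ∪ {1′,…,m′}`: `Sum.inl` are the unprimed symbols and
`Sum.inr` the primed ones (0-indexed internally, so `Sum.inl i` is the symbol `i+1`). -/
abbrev Idx (n m : ℕ) := Fin n ⊕ Fin m

/-- The one-line notation `(σ(1), …, σ(n), σ(1′), …, σ(m′))` of a permutation of `I`. -/
def oneLine {n m : ℕ} (σ : Equiv.Perm (Idx n m)) : List (Idx n m) :=
  ((List.finRange n).map fun i => σ (Sum.inl i)) ++
    ((List.finRange m).map fun j => σ (Sum.inr j))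

/-- `σ` is a shuffle: `1, 2, …, n` and `1′, 2′, …, m′` both occur as subsequences of the
one-line notation of `σ`. -/
def IsShuffle {n m : ℕ} (σ : Equiv.Perm (Idx n m)) : Prop :=
  ((List.finRange n).map Sum.inl).Sublist (oneLine σ) ∧
    ((List.finRange m).map Sum.inr).Sublist (oneLine σ)

/-- The one-line notation (with entries recorded in `ℕ ⊕ ℕ`, 0-indexed) obtained from a
word `w` by replacing each `D` by the smallest unprimed symbol not yet used and each `R`
by the smallest primed symbol not yet used: the `i`-th `D` becomes the unprimed `i` and
the `j`-th `R` becomes the primed `j`. -/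
def shListNat (w : List Bool) : List (ℕ ⊕ ℕ) :=
  (List.range w.length).map fun k =>
    if w.getD k Rl = Dl then Sum.inl ((w.take k).count Dl)
    else Sum.inr ((w.take k).count Rl)

/-- `σ = sh(w)`: the one-line notation of the permutation `σ` of `I` coincides with the
list obtained from `w` by replacing each `D` by the smallest unprimed symbol not yet used
and each `R` by the smallest primed symbol not yet used. -/
def IsShOf {n m : ℕ} (w : List Bool) (σ : Equiv.Perm (Idx n m)) : Prop :=
  (oneLine σ).map (Sum.map Fin.val Fin.val) = shListNat w

theorem getElem?_shListNat (w : List Bool) (l : ℕ) :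
    (shListNat w)[l]? = w[l]?.map fun x =>
      if x = Dl then Sum.inl ((w.take l).count Dl) else Sum.inr ((w.take l).count Rl) := by
  by_cases hl : l < w.length
  · simp [shListNat, hl]
  · simp [shListNat, hl]

/-- Replacing a consecutive pair `D, R` by `R, D` exchanges the two corresponding symbols. -/
theorem shListNat_exchange (u v : List Bool) (hnd : (shListNat (u ++ Dl :: Rl :: v)).Nodup) :
    shListNat (u ++ Rl :: Dl :: v) = (shListNat (u ++ Dl :: Rl :: v)).map
      (Equiv.swap (Sum.inl (u.count Dl)) (Sum.inr (u.count Rl))) := by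
  have hp : (shListNat (u ++ Dl :: Rl :: v))[u.length]? = some (Sum.inl (u.count Dl)) := by
    simp [getElem?_shListNat]
  have hq : (shListNat (u ++ Dl :: Rl :: v))[u.length + 1]? = some (Sum.inr (u.count Rl)) := by
    simp [getElem?_shListNat, List.take_length_add_append, Dl, Rl]
  refine List.ext_getElem? fun l => ?_
  rw [List.getElem?_map]
  by_cases hlp : l = u.length
  · subst hlp
    rw [hp]
    simp [getElem?_shListNat, Dl, Rl]
  by_cases hlq : l = u.length + 1
  · subst hlq
    rw [hq]
    simp [getElem?_shListNat, List.take_length_add_append, Dl, Rl]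
  have hsame : (shListNat (u ++ Rl :: Dl :: v))[l]? = (shListNat (u ++ Dl :: Rl :: v))[l]? := by
    rw [getElem?_shListNat, getElem?_shListNat]
    rcases Nat.lt_or_ge l u.length with h | h
    · rw [List.getElem?_append_left h, List.getElem?_append_left h,
        List.take_append_of_le_length h.le, List.take_append_of_le_length h.le]
    · obtain ⟨d, rfl⟩ : ∃ d, l = u.length + (d + 2) := ⟨l - u.length - 2, by omega⟩
      simp [List.take_length_add_append, List.getElem?_append_right, Dl, Rl]
  rw [hsame]
  cases hx : (shListNat (u ++ Dl :: Rl :: v))[l]? with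
  | none => rfl
  | some x =>
    obtain ⟨hl, -⟩ := List.getElem?_eq_some_iff.1 hx
    rw [Option.map_some, Equiv.swap_apply_of_ne_of_ne]
    · rintro rfl
      exact hlp ((List.getElem?_inj hl hnd).1 (hx.trans hp.symm))
    · rintro rfl
      exact hlq ((List.getElem?_inj hl hnd).1 (hx.trans hq.symm))

theorem nodup_oneLine {n m : ℕ} (σ : Equiv.Perm (Idx n m)) : (oneLine σ).Nodup := by
  refine List.Nodup.append ?_ ?_ ?_
  · exact (List.nodup_finRange n).map (σ.injective.comp Sum.inl_injective)
  · exact (List.nodup_finRange m).map (σ.injective.comp Sum.inr_injective)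
  · intro x hx hy
    obtain ⟨a, -, rfl⟩ := List.mem_map.1 hx
    obtain ⟨b, -, hb⟩ := List.mem_map.1 hy
    exact Sum.inr_ne_inl (σ.injective hb)

theorem oneLine_mul {n m : ℕ} (τ σ : Equiv.Perm (Idx n m)) :
    oneLine (τ * σ) = (oneLine σ).map τ := by
  simp [oneLine, Function.comp_def]

theorem exists_split_of_getElem? {α : Type*} {w : List α} {p : ℕ} {x y : α}
    (hx : w[p]? = some x) (hy : w[p + 1]? = some y) :
    ∃ u v, u.length = p ∧ w = u ++ x :: y :: v := by
  obtain ⟨hp, rfl⟩ := List.getElem?_eq_some_iff.1 hx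
  obtain ⟨hq, rfl⟩ := List.getElem?_eq_some_iff.1 hy
  refine ⟨w.take p, w.drop (p + 2), by simp; omega, ?_⟩
  rw [← List.drop_eq_getElem_cons hq, ← List.drop_eq_getElem_cons hp, List.take_append_drop]

/-- Suppose `i` and `j′` occur as the `k`-th and `(k+1)`-th entries of
the one-line notation of `sh(w)` (entries counted from `1`, so at list indices `k-1` and
`k`).  Then the `k`-th and `(k+1)`-th letters of `w` are `D` and `R` respectively, and if
`p_α(w)` is the word obtained from `w` by replacing this occurrence of `D, R` by `R, D`,
then `sh(p_α(w)) = (i j′) ∘ sh(w)`. -/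
theorem sh_odd_reflection (n m : ℕ) (hn : 0 < n) (hm : 0 < m)
    (w : List Bool) (hw : IsWord n m w)
    (σ : Equiv.Perm (Idx n m)) (hσ : IsShOf w σ)
    (i j : ℕ) (hi1 : 1 ≤ i) (hin : i ≤ n) (hj1 : 1 ≤ j) (hjm : j ≤ m)
    (k : ℕ) (hk : 1 ≤ k)
    (hki : (oneLine σ)[k - 1]? = some (Sum.inl ⟨i - 1, by omega⟩))
    (hkj : (oneLine σ)[k]? = some (Sum.inr ⟨j - 1, by omega⟩)) :
    w[k - 1]? = some Dl ∧ w[k]? = some Rl ∧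
    IsShOf ((w.set (k - 1) Rl).set k Dl)
      (Equiv.swap (Sum.inl ⟨i - 1, by omega⟩) (Sum.inr ⟨j - 1, by omega⟩) * σ) := by
  obtain ⟨p, rfl⟩ : ∃ p, k = p + 1 := ⟨k - 1, by omega⟩
  rw [Nat.add_sub_cancel] at hki ⊢
  have hi := congrArg (Option.map (Sum.map Fin.val Fin.val)) hki
  have hj := congrArg (Option.map (Sum.map Fin.val Fin.val)) hkj
  have hnd : (shListNat w).Nodup := by
    rw [← hσ]
    exact (nodup_oneLine σ).map (Sum.map_injective.2 ⟨Fin.val_injective, Fin.val_injective⟩)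
  rw [← List.getElem?_map, hσ, getElem?_shListNat] at hi hj
  have hD : w[p]? = some Dl := by
    cases hx : w[p]? with
    | none => simp [hx] at hi
    | some x => cases x <;> simp [hx, Dl] at hi ⊢
  have hR : w[p + 1]? = some Rl := by
    cases hx : w[p + 1]? with
    | none => simp [hx] at hj
    | some x => cases x <;> simp [hx, Dl, Rl] at hj ⊢
  refine ⟨hD, hR, ?_⟩
  obtain ⟨u, v, rfl, rfl⟩ := exists_split_of_getElem? hD hR
  have hu : u.count Dl = i - 1 := by simpa using hi
  have hv : u.count Rl = j - 1 := by
    simpa [List.take_length_add_append, Dl, Rl] using hj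
  have hset : ((u ++ Dl :: Rl :: v).set u.length Rl).set (u.length + 1) Dl =
      u ++ Rl :: Dl :: v := by
    simp
  rw [IsShOf, hset, shListNat_exchange u v hnd, oneLine_mul, ← hσ, List.map_map, List.map_map,
    hu, hv]
  refine List.map_congr_left fun x _ => ?_
  exact (Sum.map_injective.2 ⟨Fin.val_injective, Fin.val_injective⟩).map_swap _ _ x
end

section
/- Let n, m be positive integers, w_0 ∈ 𝒲 a word, and k_0 ∈ ℤ. Then the set E := {(w_i, k_i) : 0 ≤ i < m+n} is exactly the ∼-equivalence class of (w_0, k_0) in 𝒲 × ℤ. -/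
/-- The generating relation for `∼` on `𝒲 × ℤ`:
`(xD, k) ∼ (Dx, k + m)` and `(Rx, k) ∼ (xR, k + n)` for every string `x` of length
`m + n - 1`. -/
inductive WRel (n m : ℕ) : List Bool × ℤ → List Bool × ℤ → Prop
  | row (x : List Bool) (k : ℤ) (hx : x.length = m + n - 1) :
      WRel n m (x ++ [Dl], k) (Dl :: x, k + m)
  | col (x : List Bool) (k : ℤ) (hx : x.length = m + n - 1) :
      WRel n m (Rl :: x, k) (x ++ [Rl], k + n)

/-- The generating relation for `≈` on `𝒲 × ℤ` (only the row rule):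
`(xD, k) ≈ (Dx, k + m)` for every string `x` of length `m + n - 1`. -/
inductive WRelRow (n m : ℕ) : List Bool × ℤ → List Bool × ℤ → Prop
  | row (x : List Bool) (k : ℤ) (hx : x.length = m + n - 1) :
      WRelRow n m (x ++ [Dl], k) (Dl :: x, k + m)

/-- `w_i`: the word obtained from `w` by moving its first `i` letters (in order) to
the end. -/
def rotWord (w : List Bool) (i : ℕ) : List Bool := w.drop i ++ w.take i

/-- `k_i = k_0 + n·Σ_{j=1}^{i} c_j − m·Σ_{j=1}^{i} d_j`, where `c_j = 1` iff the `j`-th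
letter of `w` is `R` and `d_j = 1` iff it is `D` (so the sums are the numbers of `R`'s
and `D`'s among the first `i` letters of `w`). -/
def rotK (n m : ℕ) (w : List Bool) (k0 : ℤ) (i : ℕ) : ℤ :=
  k0 + (n : ℤ) * ((w.take i).count Rl : ℤ) - (m : ℤ) * ((w.take i).count Dl : ℤ)

/-- Move the first letter to the end, adding `n` to the integer if that letter is `R` and
subtracting `m` if it is `D`. -/
def rotStep (n m : ℕ) : List Bool × ℤ → List Bool × ℤ
  | ([], k) => ([], k)
  | (true :: x, k) => (x ++ [true], k + n)
  | (false :: x, k) => (x ++ [false], k - m)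

theorem rotStep_injective (n m : ℕ) : Function.Injective (rotStep n m) := by
  rintro ⟨_ | ⟨_ | _, x⟩, k⟩ ⟨_ | ⟨_ | _, y⟩, l⟩ h <;>
    simp_all [rotStep, List.append_eq_append_iff, List.cons_eq_append_iff]

theorem WRel.rotStep_eq_or {n m : ℕ} {p q : List Bool × ℤ} (h : WRel n m p q) :
    rotStep n m p = q ∨ rotStep n m q = p := by
  cases h with
  | row x k hx => right; simp [rotStep, Dl]
  | col x k hx => left; simp [rotStep, Rl]

theorem eqvGen_rotStep {n m : ℕ} (p : List Bool × ℤ) (hp : p.1.length = m + n) :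
    Relation.EqvGen (WRel n m) p (rotStep n m p) := by
  obtain ⟨_ | ⟨_ | _, x⟩, k⟩ := p
  · exact .refl _
  · have h := WRel.row (n := n) (m := m) x (k - m) (by simp at hp; omega)
    rw [sub_add_cancel] at h
    exact .symm _ _ (.rel _ _ h)
  · exact .rel _ _ (WRel.col x k (by simp at hp; omega))

theorem rotStep_rot (n m : ℕ) (w : List Bool) (k : ℤ) {i : ℕ} (hi : i < w.length) :
    rotStep n m (rotWord w i, rotK n m w k i) =
      (rotWord w (i + 1), rotK n m w k (i + 1)) := by
  simp only [rotWord, rotK, List.drop_eq_getElem_cons hi, ← List.take_append_getElem hi]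
  cases w[i] <;> simp [rotStep, Rl, Dl] <;> ring

theorem length_rotWord (w : List Bool) (i : ℕ) : (rotWord w i).length = w.length := by
  simp [rotWord]
  omega

theorem rot_zero (n m : ℕ) (w : List Bool) (k : ℤ) :
    (rotWord w 0, rotK n m w k 0) = (w, k) := by
  simp [rotWord, rotK]

theorem IsWord.rot_length {n m : ℕ} {w : List Bool} (hw : IsWord n m w) (k : ℤ) :
    (rotWord w (m + n), rotK n m w k (m + n)) = (w, k) := by
  obtain ⟨hl, hR⟩ := hw
  have hD : w.count Dl = n := by
    have := List.count_true_add_count_false w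
    simp only [Rl, Dl] at *
    omega
  rw [← hl]
  simp only [rotWord, rotK, List.drop_length, List.take_length, List.nil_append, hR, hD]
  congr 1
  ring

theorem IsWord.rotStep_mem_iff {n m : ℕ} (h0 : 0 < m + n) {w : List Bool}
    (hw : IsWord n m w) (k : ℤ) (p : List Bool × ℤ) :
    (∃ i < m + n, rotStep n m p = (rotWord w i, rotK n m w k i)) ↔
      ∃ i < m + n, p = (rotWord w i, rotK n m w k i) := by
  constructor
  · rintro ⟨_ | i, hi, h⟩
    · refine ⟨m + n - 1, by omega, rotStep_injective n m ?_⟩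
      rw [h, rotStep_rot n m w k (by rw [hw.1]; omega), Nat.sub_add_cancel h0,
        hw.rot_length, rot_zero]
    · refine ⟨i, by omega, rotStep_injective n m ?_⟩
      rw [h, rotStep_rot n m w k (by rw [hw.1]; omega)]
  · rintro ⟨i, hi, rfl⟩
    rw [rotStep_rot n m w k (by rw [hw.1]; exact hi)]
    rcases Nat.lt_or_ge (i + 1) (m + n) with h | h
    · exact ⟨i + 1, h, rfl⟩
    · have h : i + 1 = m + n := by omega
      exact ⟨0, h0, by rw [h, hw.rot_length, rot_zero]⟩

/-- Corollary 2.13(a) of the paper. The set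
`E = {(w_i, k_i) : 0 ≤ i < m+n}` is exactly the `∼`-equivalence class of `(w_0, k_0)`. -/
theorem eqv_class_eq_rotations (n m : ℕ) (hn : 0 < n) (hm : 0 < m)
    (w0 : List Bool) (hw : IsWord n m w0) (k0 : ℤ) :
    {p : List Bool × ℤ | Relation.EqvGen (WRel n m) (w0, k0) p} =
      {p : List Bool × ℤ | ∃ i < m + n, p = (rotWord w0 i, rotK n m w0 k0 i)} := by
  ext p
  simp only [Set.mem_ofPred_eq]
  constructor
  · have key : ∀ a b, Relation.EqvGen (WRel n m) a b →
        ((∃ i < m + n, a = (rotWord w0 i, rotK n m w0 k0 i)) ↔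
          ∃ i < m + n, b = (rotWord w0 i, rotK n m w0 k0 i)) := by
      intro a b h
      induction h with
      | rel a b h =>
        rcases h.rotStep_eq_or with rfl | rfl
        · exact (hw.rotStep_mem_iff (by omega) k0 a).symm
        · exact hw.rotStep_mem_iff (by omega) k0 b
      | refl a => rfl
      | symm a b _ ih => exact ih.symm
      | trans a b c _ _ ih₁ ih₂ => exact ih₁.trans ih₂
    exact fun h => (key _ _ h).1 ⟨0, by omega, (rot_zero n m w0 k0).symm⟩
  · rintro ⟨i, hi, rfl⟩
    induction i with
    | zero =>
      rw [rot_zero]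
      exact .refl _
    | succ i ih =>
      rw [← rotStep_rot n m w0 k0 (by rw [hw.1]; omega)]
      exact .trans _ _ _ (ih (by omega))
        (eqvGen_rotStep _ (by rw [length_rotWord, hw.1]))
end

section
/- Let n, m be coprime positive integers, w_0 ∈ 𝒲 a word whose last letter is R, and k_0 ∈ ℤ. If 0 ≤ i < m+n and m divides k_i − k_0, then Σ_{j=1}^{i} c_j = 0. -/
/-- Corollary 2.13(e) of the paper. If `m, n` are coprime, the last
letter of `w_0` is `R`, `0 ≤ i < m+n` and `m` divides `k_i − k_0`, then
`Σ_{j=1}^{i} c_j = 0`. -/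
theorem count_R_eq_zero_of_m_dvd (n m : ℕ) (hn : 0 < n) (hm : 0 < m)
    (hco : Nat.Coprime n m) (w0 : List Bool) (hw : IsWord n m w0)
    (hlast : ∃ x, w0 = x ++ [Rl]) (k0 : ℤ)
    (i : ℕ) (hi : i < m + n) (hdvd : (m : ℤ) ∣ rotK n m w0 k0 i - k0) :
    (w0.take i).count Rl = 0 := by
  obtain ⟨x, rfl⟩ := hlast
  obtain ⟨hlen, hcount⟩ := hw
  have hx : x.length + 1 = m + n := by simpa using hlen
  have hcx : x.count Rl + 1 = m := by simpa using hcount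
  rw [List.take_append_of_le_length (by omega)]
  have hlt : (x.take i).count Rl < m := by
    have := (List.take_sublist i x).count_le Rl
    omega
  have hmul : (m : ℤ) ∣ (n : ℤ) * ((x.take i).count Rl : ℤ) := by
    rw [rotK, List.take_append_of_le_length (by omega)] at hdvd
    obtain ⟨t, ht⟩ := hdvd
    exact ⟨t + ((x.take i).count Dl : ℤ), by linear_combination ht⟩
  have hdiv : m ∣ (x.take i).count Rl := hco.symm.dvd_of_dvd_mul_left (by exact_mod_cast hmul)
  exact Nat.eq_zero_of_dvd_of_lt hdiv hlt
end

section
/- Let n, m be coprime positive integers and fix α = ε_i − δ_j with i ∈ {1,…,n}, j ∈ {1,…,m}. (i) If a, b, a′, b′ ∈ ℤ satisfy an + bm = a′n + b′m, then η^a ν^b α = η^{a′} ν^{b′} α; hence for every k ∈ ℤ the box α_k := η^a ν^b α, where k = an + bm, is well defined. (ii) If (λ, k) ∼ (μ, ℓ) in X × ℤ, B(α_k) is an outer corner of λ, and B(α_ℓ) is an outer corner of μ, then (t_{α_k}(λ), k) ∼ (t_{α_ℓ}(μ), ℓ). -/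
/-- The cycle `1 ↦ 2 ↦ ⋯ ↦ n ↦ 1` on `{1, …, n} ⊆ ℕ` (identity elsewhere). -/
def cycUp (n : ℕ) : Equiv.Perm ℕ where
  toFun i := if 1 ≤ i ∧ i < n then i + 1 else if i = n ∧ 1 ≤ n then 1 else i
  invFun i := if 2 ≤ i ∧ i ≤ n then i - 1 else if i = 1 ∧ 1 ≤ n then n else i
  left_inv := by intro i; dsimp only; split_ifs <;> omega
  right_inv := by intro i; dsimp only; split_ifs <;> omega

/-- The rotation operator `ν` on boxes: `ν(ε_i - δ_j) = ε_{i+1} - δ_j` with the row index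
taken mod `n` (so `ν(ε_n - δ_j) = ε_1 - δ_j`); a box is recorded as its (row, column)
pair. -/
def nuPerm (n : ℕ) : Equiv.Perm (ℕ × ℕ) :=
  (cycUp n).prodCongr (Equiv.refl ℕ)

/-- The rotation operator `η` on boxes: `η(ε_i - δ_j) = ε_i - δ_{j-1}` with the column
index taken mod `m` (so `η(ε_i - δ_1) = ε_i - δ_m`). -/
def etaPerm (m : ℕ) : Equiv.Perm (ℕ × ℕ) :=
  (Equiv.refl ℕ).prodCongr (cycUp m)⁻¹

/-- The generating relation for `∼` on `X × ℤ`: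
`(λ, k) ∼ (λ^{-r}, k + m)` whenever `λ_1 = m`, and `(λ, k) ∼ (λ^{-c}, k + n)` whenever
`λ_n ≥ 1`. -/
inductive XRel (n m : ℕ) : YD n m × ℤ → YD n m × ℤ → Prop
  | row (lam : YD n m) (k : ℤ) (h : lam.part 1 = m) :
      XRel n m (lam, k) (lam.rowDel, k + m)
  | col (lam : YD n m) (k : ℤ) (h : 1 ≤ lam.part n) :
      XRel n m (lam, k) (lam.colDel, k + n)

namespace YD

variable {n m : ℕ}

theorem ext_part {lam mu : YD n m} (h : ∀ s, lam.part s = mu.part s) : lam = mu := by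
  cases lam
  cases mu
  congr
  exact funext h

theorem part_le (lam : YD n m) (s : ℕ) : lam.part s ≤ m := by
  rcases Nat.eq_zero_or_pos s with rfl | hs
  · simp [lam.at_zero]
  · exact (lam.mono le_rfl hs).trans lam.le_m

theorem rowDel_part (lam : YD n m) (s : ℕ) :
    lam.rowDel.part s = if s = 0 then 0 else lam.part (s + 1) := rfl

theorem rowAdd_part (lam : YD n m) (s : ℕ) :
    lam.rowAdd.part s =
      if s = 0 ∨ n < s then 0 else if s = 1 then m else lam.part (s - 1) := rfl

theorem colDel_part (lam : YD n m) (s : ℕ) : lam.colDel.part s = lam.part s - 1 := rfl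

theorem colAdd_part (lam : YD n m) (s : ℕ) :
    lam.colAdd.part s = if s = 0 ∨ n < s then 0 else min m (lam.part s + 1) := rfl

theorem rowAdd_rowDel (lam : YD n m) (h : lam.part 1 = m) : lam.rowDel.rowAdd = lam := by
  refine ext_part fun s => ?_
  have h0 := lam.at_zero
  have hout := lam.outside s
  rw [rowAdd_part, rowDel_part]
  split_ifs with h1 h2 h3
  · rcases h1 with rfl | h1
    · exact h0.symm
    · exact (hout h1).symm
  · rw [h2, h]
  · omega
  · congr 1
    omega

theorem colAdd_colDel (lam : YD n m) (h : 1 ≤ lam.part n) : lam.colDel.colAdd = lam := by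
  refine ext_part fun s => ?_
  have h0 := lam.at_zero
  have hout := lam.outside s
  have hle := lam.part_le s
  rw [colAdd_part, colDel_part]
  split_ifs with h1
  · rcases h1 with rfl | h1
    · exact h0.symm
    · exact (hout h1).symm
  · have := @lam.mono s n (by omega) (by omega)
    omega

theorem colDel_colAdd (lam : YD n m) (h : lam.part 1 < m) : lam.colAdd.colDel = lam := by
  refine ext_part fun s => ?_
  have h0 := lam.at_zero
  have hout := lam.outside s
  rw [colDel_part, colAdd_part]
  split_ifs with h1
  · rcases h1 with rfl | h1
    · exact h0.symm
    · exact (hout h1).symm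
  · have := @lam.mono 1 s le_rfl (by omega)
    omega

/-- The diagram `mu` arises from `lam` by lengthening the row of `B(ε_i - δ_j)` from `j - 1`
to `j`. -/
def AddsBox (lam : YD n m) (p : ℕ × ℕ) (mu : YD n m) : Prop :=
  1 ≤ p.1 ∧ p.1 ≤ n ∧ p.2 ≤ m ∧ lam.part (n + 1 - p.1) + 1 = p.2 ∧
    ∀ s, mu.part s = if s = n + 1 - p.1 then p.2 else lam.part s

theorem AddsBox.unique {lam mu mu' : YD n m} {p : ℕ × ℕ} (h : lam.AddsBox p mu)
    (h' : lam.AddsBox p mu') : mu = mu' :=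
  ext_part fun s => (h.2.2.2.2 s).trans (h'.2.2.2.2 s).symm

theorem OuterCorner.addsBox {lam mu : YD n m} {p : ℕ × ℕ} (h : lam.OuterCorner p.1 p.2)
    (hadd : lam.IsAdd p.1 p.2 mu) : lam.AddsBox p mu := by
  obtain ⟨i, j⟩ := p
  obtain ⟨hi1, hin, hj1, hjm, hnot, -⟩ := h
  dsimp only at *
  have key : ∀ s, 1 ≤ s → s ≤ n → ∀ t, 1 ≤ t → t ≤ m →
      (t ≤ mu.part s ↔ t ≤ lam.part s ∨ (s = n + 1 - i ∧ t = j)) := by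
    intro s hs hsn t ht htm
    have := hadd (n + 1 - s) t
    simp only [mem] at this
    have e : n + 1 - (n + 1 - s) = s := by omega
    rw [e] at this
    have e2 : n + 1 - s = i ↔ s = n + 1 - i := by omega
    rw [e2] at this
    have l1 : 1 ≤ n + 1 - s := by omega
    have l2 : n + 1 - s ≤ n := by omega
    simpa [l1, l2, ht, htm] using this
  have hlt : lam.part (n + 1 - i) < j := by
    by_contra hc
    exact hnot ⟨hi1, hin, hj1, hjm, by omega⟩
  have hmu : j ≤ mu.part (n + 1 - i) :=
    (key _ (by omega) (by omega) j hj1 hjm).2 (Or.inr ⟨rfl, rfl⟩)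
  have hrow : lam.part (n + 1 - i) + 1 = j := by
    by_contra hc
    have := (key (n + 1 - i) (by omega) (by omega) (j - 1) (by omega) (by omega)).1 (by omega)
    omega
  refine ⟨hi1, hin, hjm, hrow, fun s => ?_⟩
  dsimp only
  have hmus := mu.part_le s
  have hlams := lam.part_le s
  split_ifs with hs
  · subst hs
    by_contra hc
    have := (key (n + 1 - i) (by omega) (by omega) (j + 1) (by omega) (by omega)).1 (by omega)
    omega
  · by_cases hs0 : s = 0
    · rw [hs0, mu.at_zero, lam.at_zero]
    by_cases hsn : n < s
    · rw [mu.outside s hsn, lam.outside s hsn]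
    have key' := key s (by omega) (by omega)
    apply le_antisymm
    · by_cases h0 : mu.part s = 0
      · omega
      · have := (key' (mu.part s) (by omega) hmus).1 le_rfl
        omega
    · by_cases h0 : lam.part s = 0
      · omega
      · exact (key' (lam.part s) (by omega) hlams).2 (Or.inl le_rfl)

/-- Rotation of the boundary path of a diagram by one step: a vertical last step is moved to the
front by `rowDel`, a horizontal one by `colAdd`. -/
def rotate (x : YD n m × ℤ) : YD n m × ℤ :=
  if x.1.part 1 = m then (x.1.rowDel, x.2 + m) else (x.1.colAdd, x.2 - n)

theorem rotate_of_eq {lam : YD n m} (k : ℤ) (h : lam.part 1 = m) :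
    rotate (lam, k) = (lam.rowDel, k + m) := if_pos h

theorem rotate_of_lt {lam : YD n m} (k : ℤ) (h : lam.part 1 < m) :
    rotate (lam, k) = (lam.colAdd, k - n) := if_neg h.ne

theorem rotate_injective (hn : 0 < n) (hm : 0 < m) :
    Function.Injective (rotate : YD n m × ℤ → YD n m × ℤ) := by
  refine Function.LeftInverse.injective
    (g := fun x : YD n m × ℤ => if 1 ≤ x.1.part n then (x.1.colDel, x.2 + n) else (x.1.rowAdd, x.2 - m)) ?_
  rintro ⟨lam, k⟩
  rcases lam.le_m.eq_or_lt with h | h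
  · have : ¬ 1 ≤ lam.rowDel.part n := by
      simp [rowDel_part, lam.outside]
    simp only [rotate_of_eq k h, this, if_false, lam.rowAdd_rowDel h, add_sub_cancel_right]
  · have : 1 ≤ lam.colAdd.part n := by
      rw [colAdd_part, if_neg (by omega)]
      omega
    simp only [rotate_of_lt k h, this, if_true, lam.colDel_colAdd h, sub_add_cancel]

theorem eqvGen_rotate (hn : 0 < n) (hm : 0 < m) (x : YD n m × ℤ) :
    Relation.EqvGen (XRel n m) x (rotate x) := by
  obtain ⟨lam, k⟩ := x
  rcases lam.le_m.eq_or_lt with h | h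
  · rw [rotate_of_eq k h]
    exact .rel _ _ (.row lam k h)
  · rw [rotate_of_lt k h]
    have hpos : 1 ≤ lam.colAdd.part n := by
      rw [colAdd_part, if_neg (by omega)]
      omega
    have := XRel.col lam.colAdd (k - n) hpos
    rw [lam.colDel_colAdd h, sub_add_cancel] at this
    exact .symm _ _ (.rel _ _ this)

theorem eqvGen_rotate_iterate (hn : 0 < n) (hm : 0 < m) (s : ℕ) (x : YD n m × ℤ) :
    Relation.EqvGen (XRel n m) x (rotate^[s] x) := by
  induction s with
  | zero => exact .refl _
  | succ s ih =>
    rw [Function.iterate_succ_apply']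
    exact ih.trans _ _ _ (eqvGen_rotate hn hm _)

theorem rotate_of_xRel (hn : 0 < n) {x y : YD n m × ℤ} (h : XRel n m x y) :
    rotate x = y ∨ rotate y = x := by
  cases h with
  | row lam k h => exact Or.inl (rotate_of_eq k h)
  | col lam k h =>
    right
    have h1 := @lam.mono 1 n le_rfl hn
    have h2 := lam.le_m
    rw [rotate_of_lt _ (by rw [colDel_part]; omega), lam.colAdd_colDel h, add_sub_cancel_right]

theorem exists_rotate_iterate (hn : 0 < n) (hm : 0 < m) {x y : YD n m × ℤ}
    (h : Relation.EqvGen (XRel n m) x y) :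
    ∃ s : ℕ, rotate^[s] x = y ∨ rotate^[s] y = x := by
  have hmeet : ∃ s t : ℕ, rotate^[s] x = rotate^[t] y := by
    induction h with
    | rel x y h =>
      rcases rotate_of_xRel hn h with h | h
      · exact ⟨1, 0, h⟩
      · exact ⟨0, 1, h.symm⟩
    | refl x => exact ⟨0, 0, rfl⟩
    | symm x y _ ih =>
      obtain ⟨s, t, h⟩ := ih
      exact ⟨t, s, h.symm⟩
    | trans x y z _ _ ih₁ ih₂ =>
      obtain ⟨s, t, h₁⟩ := ih₁
      obtain ⟨u, v, h₂⟩ := ih₂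
      refine ⟨u + s, t + v, ?_⟩
      rw [Function.iterate_add_apply, h₁, ← Function.iterate_add_apply, add_comm u t,
        Function.iterate_add_apply, h₂, ← Function.iterate_add_apply]
  obtain ⟨s, t, h⟩ := hmeet
  have hinj := rotate_injective (n := n) (m := m) hn hm
  rcases le_total t s with hts | hst
  · refine ⟨s - t, Or.inl (hinj.iterate t ?_)⟩
    rw [← Function.iterate_add_apply, Nat.add_sub_cancel' hts, h]
  · refine ⟨t - s, Or.inr (hinj.iterate s ?_)⟩
    rw [← Function.iterate_add_apply, Nat.add_sub_cancel' hst, h]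

end YD

theorem cycUp_apply_of_lt {n i : ℕ} (h1 : 1 ≤ i) (h : i < n) : cycUp n i = i + 1 :=
  if_pos ⟨h1, h⟩

theorem cycUp_apply_self {n : ℕ} (hn : 0 < n) : cycUp n n = 1 := by
  simp [cycUp, Nat.one_le_iff_ne_zero, hn.ne']

theorem cycUp_pow_apply_one {n t : ℕ} (ht : t < n) : (cycUp n ^ t) 1 = t + 1 := by
  induction t with
  | zero => rfl
  | succ t ih =>
    rw [pow_succ', Equiv.Perm.mul_apply, ih (by omega), cycUp_apply_of_lt (by omega) ht]

theorem cycUp_pow_self_apply {n i : ℕ} (h1 : 1 ≤ i) (hin : i ≤ n) : (cycUp n ^ n) i = i := by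
  have hone : (cycUp n ^ n) 1 = 1 := by
    obtain ⟨t, rfl⟩ : ∃ t, n = t + 1 := ⟨n - 1, by omega⟩
    rw [pow_succ', Equiv.Perm.mul_apply, cycUp_pow_apply_one (by omega),
      cycUp_apply_self (by omega)]
  have hi : (cycUp n ^ (i - 1)) 1 = i := by
    rw [cycUp_pow_apply_one (by omega)]
    omega
  rw [← hi, ← Equiv.Perm.mul_apply, ← pow_add, add_comm, pow_add, Equiv.Perm.mul_apply, hone]

theorem cycUp_zpow_apply_congr {n i : ℕ} (h1 : 1 ≤ i) (hin : i ≤ n) {b b' : ℤ}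
    (h : (n : ℤ) ∣ b - b') : (cycUp n ^ b) i = (cycUp n ^ b') i := by
  obtain ⟨c, hc⟩ := h
  obtain rfl : b = b' + n * c := by omega
  rw [zpow_add, zpow_mul, zpow_natCast, Equiv.Perm.mul_apply,
    Equiv.Perm.zpow_apply_eq_self_of_apply_eq_self (cycUp_pow_self_apply h1 hin)]

theorem nuPerm_zpow_apply (n : ℕ) (b : ℤ) (p : ℕ × ℕ) :
    (nuPerm n ^ b) p = ((cycUp n ^ b) p.1, p.2) := by
  have hnat : ∀ (t : ℕ) (p : ℕ × ℕ), (nuPerm n ^ t) p = ((cycUp n ^ t) p.1, p.2) := by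
    intro t
    induction t with
    | zero => intro p; rfl
    | succ t ih =>
      intro p
      rw [pow_succ, pow_succ, Equiv.Perm.mul_apply, Equiv.Perm.mul_apply, ih]
      rfl
  cases b with
  | ofNat t => exact hnat t p
  | negSucc t =>
    rw [zpow_negSucc, zpow_negSucc, Equiv.Perm.inv_eq_iff_eq, hnat]
    simp

theorem etaPerm_zpow_apply (m : ℕ) (a : ℤ) (p : ℕ × ℕ) :
    (etaPerm m ^ a) p = (p.1, (cycUp m ^ (-a)) p.2) := by
  have hnat : ∀ (t : ℕ) (p : ℕ × ℕ), (etaPerm m ^ t) p = (p.1, ((cycUp m)⁻¹ ^ t) p.2) := by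
    intro t
    induction t with
    | zero => intro p; rfl
    | succ t ih =>
      intro p
      rw [pow_succ, pow_succ, Equiv.Perm.mul_apply, Equiv.Perm.mul_apply, ih]
      rfl
  rw [zpow_neg, ← inv_zpow]
  cases a with
  | ofNat t => exact hnat t p
  | negSucc t =>
    rw [zpow_negSucc, zpow_negSucc, Equiv.Perm.inv_eq_iff_eq, hnat]
    simp

theorem box_zpow_apply (n m : ℕ) (a b : ℤ) (p : ℕ × ℕ) :
    (etaPerm m ^ a * nuPerm n ^ b) p = ((cycUp n ^ b) p.1, (cycUp m ^ (-a)) p.2) := by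
  rw [Equiv.Perm.mul_apply, nuPerm_zpow_apply, etaPerm_zpow_apply]

theorem box_zpow_apply_congr {n m i j : ℕ} (hco : Nat.Coprime n m)
    (hi1 : 1 ≤ i) (hin : i ≤ n) (hj1 : 1 ≤ j) (hjm : j ≤ m) {a b a' b' : ℤ}
    (h : a * n + b * m = a' * n + b' * m) :
    (etaPerm m ^ a * nuPerm n ^ b) (i, j) = (etaPerm m ^ a' * nuPerm n ^ b') (i, j) := by
  have hco' : IsCoprime (n : ℤ) (m : ℤ) := Nat.isCoprime_iff_coprime.2 hco
  have hb : (n : ℤ) ∣ b - b' :=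
    hco'.dvd_of_dvd_mul_right ⟨a' - a, by linear_combination h⟩
  have ha : (m : ℤ) ∣ -a - -a' :=
    hco'.symm.dvd_of_dvd_mul_right ⟨b - b', by linear_combination -h⟩
  rw [box_zpow_apply, box_zpow_apply, cycUp_zpow_apply_congr hi1 hin hb,
    cycUp_zpow_apply_congr hj1 hjm ha]

/-- `p` is the box `η^a ν^b α` for some decomposition `k = a n + b m`. -/
def IsBoxAt (n m : ℕ) (α : ℕ × ℕ) (k : ℤ) (p : ℕ × ℕ) : Prop :=
  ∃ a b : ℤ, k = a * n + b * m ∧ p = (etaPerm m ^ a * nuPerm n ^ b) α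

namespace IsBoxAt

variable {n m : ℕ} {α p q : ℕ × ℕ} {k : ℤ}

theorem add_row (h : IsBoxAt n m α k p) : IsBoxAt n m α (k + m) (cycUp n p.1, p.2) := by
  obtain ⟨a, b, rfl, rfl⟩ := h
  refine ⟨a, b + 1, by ring, ?_⟩
  simp only [box_zpow_apply]
  rw [add_comm b 1, zpow_add, zpow_one, Equiv.Perm.mul_apply]

theorem sub_col (h : IsBoxAt n m α k p) : IsBoxAt n m α (k - n) (p.1, cycUp m p.2) := by
  obtain ⟨a, b, rfl, rfl⟩ := h
  refine ⟨a - 1, b, by ring, ?_⟩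
  simp only [box_zpow_apply]
  rw [neg_sub, sub_eq_add_neg, zpow_add, zpow_one, Equiv.Perm.mul_apply]

theorem unique (hco : Nat.Coprime n m) (hi1 : 1 ≤ α.1) (hin : α.1 ≤ n) (hj1 : 1 ≤ α.2)
    (hjm : α.2 ≤ m) (hp : IsBoxAt n m α k p) (hq : IsBoxAt n m α k q) : p = q := by
  obtain ⟨a, b, hk, rfl⟩ := hp
  obtain ⟨a', b', hk', rfl⟩ := hq
  exact box_zpow_apply_congr hco hi1 hin hj1 hjm (hk.symm.trans hk')

end IsBoxAt

namespace YD

variable {n m : ℕ}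

/-- Either adding the box commutes with one rotation step, or the box is at the corner `(n, m)`,
is carried to the non-addable box `(n, 1)`, and adding it commutes with two rotation steps. -/
theorem AddsBox.rotate {lam lam' : YD n m} {α p : ℕ × ℕ} {k : ℤ} (hm : 0 < m)
    (h : lam.AddsBox p lam') (hp : IsBoxAt n m α k p) :
    (∃ mu mu' l q, rotate (lam, k) = (mu, l) ∧ rotate (lam', k) = (mu', l) ∧
      IsBoxAt n m α l q ∧ mu.AddsBox q mu') ∨
    (∃ mu l q, rotate (lam, k) = (mu, l) ∧ IsBoxAt n m α l q ∧ (∀ mu', ¬ mu.AddsBox q mu') ∧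
      ∃ rho rho' l₂ q₂, rotate (mu, l) = (rho, l₂) ∧
        rotate^[2] (lam', k) = (rho', l₂) ∧ IsBoxAt n m α l₂ q₂ ∧ rho.AddsBox q₂ rho') := by
  obtain ⟨i, j⟩ := p
  obtain ⟨hi1, hin, hjm, hrow, hpart⟩ := h
  dsimp only at *
  have hle := lam.le_m
  have hle' := lam'.le_m
  have hp1 := hpart 1
  rcases hle.eq_or_lt with hlam | hlam
  · have hi : i < n := by
      by_contra hc
      rw [show n + 1 - i = 1 by omega] at hrow
      omega
    have hlam' : lam'.part 1 = m := by
      rw [hp1, if_neg (by omega), hlam]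
    have hbox := hp.add_row
    dsimp only at hbox
    rw [cycUp_apply_of_lt hi1 hi] at hbox
    refine Or.inl ⟨_, _, _, _, rotate_of_eq k hlam, rotate_of_eq k hlam', hbox,
      by dsimp only; omega, hi, hjm, ?_, fun s => ?_⟩ <;> dsimp only
    · rw [rowDel_part, if_neg (by omega), show n + 1 - (i + 1) + 1 = n + 1 - i by omega, hrow]
    · rw [rowDel_part, rowDel_part, hpart]
      split_ifs <;> omega
  rcases hle'.eq_or_lt with hlam' | hlam'
  · right
    have hcorner : 1 = n + 1 - i := by
      by_contra hc
      rw [if_neg hc] at hp1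
      omega
    obtain rfl : i = n := by omega
    rw [if_pos hcorner] at hp1
    obtain rfl : j = m := by omega
    have hbox := hp.sub_col
    dsimp only at hbox
    rw [cycUp_apply_self hm] at hbox
    have hbox₂ := hbox.add_row
    dsimp only at hbox₂
    rw [cycUp_apply_self hi1] at hbox₂
    have hmu : lam.colAdd.part 1 = j := by
      rw [← hcorner] at hrow
      rw [colAdd_part, if_neg (by omega), hrow, min_self]
    have hlt : lam'.rowDel.part 1 < j := by
      rw [rowDel_part, if_neg (by omega), hpart, if_neg (by omega)]
      have := @lam.mono 1 (1 + 1) le_rfl (by omega)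
      omega
    refine ⟨_, _, _, rotate_of_lt k hlam, hbox, ?_, _, lam'.rowDel.colAdd, _, _,
      rotate_of_eq _ hmu, ?_, hbox₂, le_rfl, hi1, hm, ?_, fun s => ?_⟩
    · rintro mu' ⟨-, -, -, hc, -⟩
      dsimp only at hc
      rw [← hcorner, hmu] at hc
      omega
    · rw [Function.iterate_succ_apply, Function.iterate_one, rotate_of_eq k hlam',
        rotate_of_lt _ hlt]
      congr 1
      ring
    · dsimp only
      rw [rowDel_part, if_neg (by omega), colAdd_part, if_pos (by omega)]
    · dsimp only
      have hout := lam.outside (s + 1)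
      rw [rowDel_part, colAdd_part, colAdd_part, rowDel_part, hpart]
      simp only [Nat.succ_ne_zero, false_or]
      split_ifs <;> omega
  · left
    have hj : j < m := by
      have := hpart (n + 1 - i)
      rw [if_pos rfl] at this
      have := @lam'.mono 1 (n + 1 - i) le_rfl (by omega)
      omega
    have hbox := hp.sub_col
    dsimp only at hbox
    rw [cycUp_apply_of_lt (by omega) hj] at hbox
    refine ⟨_, _, _, _, rotate_of_lt k hlam, rotate_of_lt k hlam', hbox, hi1, hin, hj, ?_,
      fun s => ?_⟩ <;> dsimp only
    · rw [colAdd_part, if_neg (by omega), hrow, min_eq_right hjm]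
    · rw [colAdd_part, colAdd_part, hpart]
      split_ifs <;> omega

theorem AddsBox.rotate_iterate {α : ℕ × ℕ} (hm : 0 < m) (hco : Nat.Coprime n m)
    (hi1 : 1 ≤ α.1) (hin : α.1 ≤ n) (hj1 : 1 ≤ α.2) (hjm : α.2 ≤ m)
    {mu mu' : YD n m} {l : ℤ} {q : ℕ × ℕ} (hq : IsBoxAt n m α l q) (hmu : mu.AddsBox q mu')
    (s : ℕ) : ∀ {lam lam' : YD n m} {k : ℤ} {p : ℕ × ℕ}, IsBoxAt n m α k p →
      lam.AddsBox p lam' → YD.rotate^[s] (lam, k) = (mu, l) →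
      YD.rotate^[s] (lam', k) = (mu', l) := by
  induction s using Nat.strong_induction_on with
  | _ s ih =>
    intro lam lam' k p hp hlam hs
    rcases s with _ | s
    · obtain ⟨rfl, rfl⟩ := Prod.mk.inj hs
      obtain rfl := hp.unique hco hi1 hin hj1 hjm hq
      rw [hlam.unique hmu, Function.iterate_zero_apply]
    · rw [Function.iterate_succ_apply] at hs
      rcases hlam.rotate hm hp with
        ⟨mu₁, mu₁', l₁, q₁, e, e', hq₁, hmu₁⟩ |
        ⟨mu₁, l₁, q₁, e, hq₁, hnot, rho, rho', l₂, q₂, e₂, e₂', hq₂, hrho⟩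
      · rw [e] at hs
        rw [Function.iterate_succ_apply, e']
        exact ih s (by omega) hq₁ hmu₁ hs
      · rw [e] at hs
        rcases s with _ | s
        · obtain ⟨rfl, rfl⟩ := Prod.mk.inj hs
          obtain rfl := hq₁.unique hco hi1 hin hj1 hjm hq
          exact absurd hmu (hnot mu')
        · rw [Function.iterate_succ_apply, e₂] at hs
          rw [Function.iterate_add_apply _ s 2, e₂']
          exact ih s (by omega) hq₂ hrho hs

end YD

/-- (i) If `a·n + b·m = a'·n + b'·m` then `η^a ν^b α = η^{a'} ν^{b'} α`,
so the box `α_k := η^a ν^b α` (for any decomposition `k = a·n + b·m`) is well defined.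
(ii) If `(λ, k) ∼ (μ, ℓ)`, `B(α_k)` is an outer corner of `λ` and `B(α_ℓ)` is an outer
corner of `μ`, then `(t_{α_k}(λ), k) ∼ (t_{α_ℓ}(μ), ℓ)`. -/
theorem box_action_well_defined_and_equivariant (n m : ℕ) (hn : 0 < n) (hm : 0 < m)
    (hco : Nat.Coprime n m) (i j : ℕ)
    (hi1 : 1 ≤ i) (hin : i ≤ n) (hj1 : 1 ≤ j) (hjm : j ≤ m) :
    (∀ a b a' b' : ℤ, a * n + b * m = a' * n + b' * m →
      (etaPerm m ^ a * nuPerm n ^ b) (i, j) =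
        (etaPerm m ^ a' * nuPerm n ^ b') (i, j)) ∧
    (∀ (lam mu : YD n m) (k l : ℤ),
      Relation.EqvGen (XRel n m) (lam, k) (mu, l) →
      ∀ a b a' b' : ℤ, k = a * n + b * m → l = a' * n + b' * m →
      ∀ p q : ℕ × ℕ,
        p = (etaPerm m ^ a * nuPerm n ^ b) (i, j) →
        q = (etaPerm m ^ a' * nuPerm n ^ b') (i, j) →
        lam.OuterCorner p.1 p.2 → mu.OuterCorner q.1 q.2 →
        ∀ lam' mu' : YD n m, lam.IsAdd p.1 p.2 lam' → mu.IsAdd q.1 q.2 mu' →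
          Relation.EqvGen (XRel n m) (lam', k) (mu', l)) := by
  refine ⟨fun a b a' b' h => box_zpow_apply_congr hco hi1 hin hj1 hjm h, ?_⟩
  intro lam mu k l hrel a b a' b' hk hl p q hp hq hlam hmu lam' mu' hlam' hmu'
  have hpk : IsBoxAt n m (i, j) k p := ⟨a, b, hk, hp⟩
  have hql : IsBoxAt n m (i, j) l q := ⟨a', b', hl, hq⟩
  have hlamAdd := hlam.addsBox hlam'
  have hmuAdd := hmu.addsBox hmu'
  obtain ⟨s, hs | hs⟩ := YD.exists_rotate_iterate hn hm hrel
  · rw [← hmuAdd.rotate_iterate hm hco hi1 hin hj1 hjm hql s hpk hlamAdd hs]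
    exact YD.eqvGen_rotate_iterate hn hm s _
  · rw [← hlamAdd.rotate_iterate hm hco hi1 hin hj1 hjm hpk s hql hmuAdd hs]
    exact .symm _ _ (YD.eqvGen_rotate_iterate hn hm s _)
end

section
/- Let n, m be coprime positive integers. If λ, μ ∈ X are Young diagrams in the n×m rectangle and (λ, 0) ∼ (μ, 0), then λ = μ; that is, the map X → [X × ℤ], λ ↦ [λ, 0], is injective. -/
namespace YD

variable {n m : ℕ}

/-- The integers `k + n * λ_i + m * i` for `1 ≤ i ≤ n`. Up to a shift by `n * m` these are the
heights, starting from `k`, at which the boundary path of `lam` makes a vertical step, where a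
horizontal step raises the height by `n` and a vertical step lowers it by `m`. -/
def heights (p : YD n m × ℤ) : Set ℤ :=
  {z | ∃ i : ℕ, 1 ≤ i ∧ i ≤ n ∧ z = p.2 + n * (p.1.part i : ℤ) + m * (i : ℤ)}

theorem heights_rowDel (hn : 0 < n) (lam : YD n m) (k : ℤ) (h : lam.part 1 = m) :
    heights (lam.rowDel, k + m) = heights (lam, k) := by
  ext z
  constructor
  · rintro ⟨i, hi, hin, rfl⟩
    have hi0 : i ≠ 0 := by omega
    rcases hin.lt_or_eq with hlt | rfl
    · refine ⟨i + 1, by omega, hlt, ?_⟩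
      simp only [rowDel, hi0, if_false]
      push_cast
      ring
    · refine ⟨1, le_rfl, hi, ?_⟩
      simp only [rowDel, hi0, if_false, lam.outside (i + 1) (by omega), h]
      push_cast
      ring
  · rintro ⟨i, hi, hin, rfl⟩
    rcases hi.lt_or_eq with hlt | rfl
    · obtain ⟨j, rfl⟩ : ∃ j, i = j + 1 := ⟨i - 1, by omega⟩
      have hj0 : j ≠ 0 := by omega
      refine ⟨j, by omega, by omega, ?_⟩
      simp only [rowDel, hj0, if_false]
      push_cast
      ring
    · refine ⟨n, hn, le_rfl, ?_⟩
      simp only [rowDel, hn.ne', if_false, lam.outside (n + 1) (by omega), h]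
      push_cast
      ring

theorem heights_colDel (lam : YD n m) (k : ℤ) (h : 1 ≤ lam.part n) :
    heights (lam.colDel, k + n) = heights (lam, k) := by
  ext z
  refine exists_congr fun i => and_congr_right fun hi => and_congr_right fun hin => ?_
  have hpos : 1 ≤ lam.part i := h.trans (lam.mono hi hin)
  simp only [colDel]
  rw [Nat.cast_sub hpos]
  push_cast
  ring_nf

theorem heights_eq_of_eqvGen (hn : 0 < n) {p q : YD n m × ℤ}
    (h : Relation.EqvGen (XRel n m) p q) : heights p = heights q := by
  induction h with
  | rel _ _ h =>
    cases h with
    | row lam k h => exact (heights_rowDel hn lam k h).symm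
    | col lam k h => exact (heights_colDel lam k h).symm
  | refl => rfl
  | symm _ _ _ ih => exact ih.symm
  | trans _ _ _ _ _ ih₁ ih₂ => exact ih₁.trans ih₂

theorem part_injective : Function.Injective (part : YD n m → ℕ → ℕ) := by
  rintro ⟨⟩ ⟨⟩ h
  cases h
  rfl

theorem eq_of_heights_eq (hco : Nat.Coprime n m) {lam mu : YD n m} {k : ℤ}
    (h : heights (lam, k) = heights (mu, k)) : lam = mu := by
  refine part_injective (funext fun i => ?_)
  rcases Nat.eq_zero_or_pos i with rfl | hi
  · rw [lam.at_zero, mu.at_zero]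
  rcases lt_or_ge n i with hin | hin
  · rw [lam.outside i hin, mu.outside i hin]
  have hmem : k + n * (lam.part i : ℤ) + m * (i : ℤ) ∈ heights (lam, k) := ⟨i, hi, hin, rfl⟩
  rw [h] at hmem
  obtain ⟨j, hj, hjn, e⟩ := hmem
  have hdvd : (n : ℤ) ∣ m * ((i : ℤ) - j) :=
    ⟨mu.part j - lam.part i, by linear_combination e⟩
  have hij : (i : ℤ) - j = 0 :=
    Int.eq_zero_of_abs_lt_dvd ((Nat.isCoprime_iff_coprime.mpr hco).dvd_of_dvd_mul_left hdvd)
      (abs_lt.mpr ⟨by omega, by omega⟩)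
  obtain rfl : i = j := by omega
  have hn : (n : ℤ) ≠ 0 := by omega
  exact_mod_cast mul_left_cancel₀ hn
    (by linear_combination e : (n : ℤ) * lam.part i = n * mu.part i)

end YD

/-- injectivity in Theorem 3.3(b) of the paper. If `m, n` are coprime
and `(λ, 0) ∼ (μ, 0)` then `λ = μ`; i.e. the map `X → [X × ℤ]`, `λ ↦ [λ, 0]`, is
injective. -/
theorem class_map_injective (n m : ℕ) (hn : 0 < n) (hm : 0 < m)
    (hco : Nat.Coprime n m) (lam mu : YD n m)
    (h : Relation.EqvGen (XRel n m) (lam, 0) (mu, 0)) :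
    lam = mu := by
  exact YD.eq_of_heights_eq hco (YD.heights_eq_of_eqvGen hn h)
end

section
/- Let n, m be coprime positive integers, let w_0 ∈ 𝒲 be a word whose last letter is R, and let k_0 ∈ ℤ. Set E = {(w_i, k_i) : 0 ≤ i < m+n}, and for j ∈ {0, 1, …, m−1} set 𝓔_j = {i ∈ {0,…,m+n−1} : k_i − k_0 ≡ nj (mod m)} and E_j = {(w_i, k_i) : i ∈ 𝓔_j}. Then each E_j is nonempty, E = E_0 ∪ … ∪ E_{m−1}, and the sets E_0, …, E_{m−1} are precisely the ≈-equivalence classes of the elements of E. -/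
/-- The set `E = {(w_i, k_i) : 0 ≤ i < m+n}` of rotations of `(w_0, k_0)`. -/
def Eset (n m : ℕ) (w0 : List Bool) (k0 : ℤ) : Set (List Bool × ℤ) :=
  {p | ∃ i < m + n, p = (rotWord w0 i, rotK n m w0 k0 i)}

/-- The subset `E_j = {(w_i, k_i) : i ∈ 𝓔_j}` of `E`, where
`𝓔_j = {i ∈ {0,…,m+n-1} : k_i - k_0 ≡ n·j (mod m)}`. -/
def Ejset (n m : ℕ) (w0 : List Bool) (k0 : ℤ) (j : ℕ) : Set (List Bool × ℤ) :=
  {p | ∃ i < m + n,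
    rotK n m w0 k0 i - k0 ≡ (n : ℤ) * j [ZMOD (m : ℤ)] ∧
    p = (rotWord w0 i, rotK n m w0 k0 i)}

theorem rotWord_eq_cons {w : List Bool} {i : ℕ} (hi : i < w.length) :
    rotWord w i = w[i] :: (w.drop (i + 1) ++ w.take i) := by
  rw [rotWord, List.drop_eq_getElem_cons hi, List.cons_append]

theorem rotWord_succ {w : List Bool} {i : ℕ} (hi : i < w.length) :
    rotWord w (i + 1) = (w.drop (i + 1) ++ w.take i) ++ [w[i]] := by
  rw [rotWord, List.take_succ_eq_append_getElem hi, List.append_assoc]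

theorem count_take_succ {w : List Bool} {i : ℕ} (hi : i < w.length) (a : Bool) :
    (w.take (i + 1)).count a = (w.take i).count a + if w[i] = a then 1 else 0 := by
  rw [List.take_succ_eq_append_getElem hi, List.count_append]
  simp [List.count_singleton]

theorem count_take_succ_of_eq_Dl {w : List Bool} {i : ℕ} (hi : i < w.length) (h : w[i] = Dl) :
    (w.take (i + 1)).count Rl = (w.take i).count Rl := by
  simp [count_take_succ hi, h, Dl, Rl]

theorem rotK_succ_of_eq_Dl {n m : ℕ} {w : List Bool} {k0 : ℤ} {i : ℕ} (hi : i < w.length)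
    (h : w[i] = Dl) : rotK n m w k0 (i + 1) + m = rotK n m w k0 i := by
  simp only [rotK, count_take_succ_of_eq_Dl hi h, count_take_succ hi Dl, h, if_true]
  push_cast
  ring

theorem exists_count_take_eq {w : List Bool} (a : Bool) {i j : ℕ} (hi : i ≤ w.length)
    (hj : j ≤ (w.take i).count a) : ∃ t ≤ i, (w.take t).count a = j := by
  induction i with
  | zero => exact ⟨0, le_rfl, by simp_all⟩
  | succ i ih =>
    by_cases h : j ≤ (w.take i).count a
    · obtain ⟨t, ht, rfl⟩ := ih (by lia) h
      exact ⟨t, by lia, rfl⟩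
    · refine ⟨i + 1, le_rfl, ?_⟩
      rw [count_take_succ (by lia)] at hj ⊢
      split_ifs at hj ⊢ <;> lia

section

variable {n m : ℕ} {w : List Bool} {k0 : ℤ}

theorem WRelRow.rot_succ (hw : w.length = m + n) {i : ℕ} (hi : i < w.length) (h : w[i] = Dl) :
    WRelRow n m (rotWord w (i + 1), rotK n m w k0 (i + 1)) (rotWord w i, rotK n m w k0 i) := by
  rw [rotWord_eq_cons hi, rotWord_succ hi, h, ← rotK_succ_of_eq_Dl hi h]
  exact .row _ _ (by simp; lia)

theorem eqvGen_rot_of_count_eq (hw : w.length = m + n) {i i' : ℕ} (hii : i ≤ i')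
    (hi' : i' ≤ w.length) (h : (w.take i').count Rl = (w.take i).count Rl) :
    Relation.EqvGen (WRelRow n m) (rotWord w i, rotK n m w k0 i)
      (rotWord w i', rotK n m w k0 i') := by
  induction i', hii using Nat.le_induction with
  | base => exact .refl _
  | succ t ht ih =>
    have hmono : (w.take i).count Rl ≤ (w.take t).count Rl :=
      (List.take_sublist_take_left ht).count_le _
    have hlt : t < w.length := hi'
    rw [count_take_succ hlt] at h
    have hD : w[t] = Dl := by
      split_ifs at h with hR
      · lia
      · simpa [Rl, Dl] using hR
    exact (ih hlt.le (by lia)).trans _ _ _ (.symm _ _ (.rel _ _ (.rot_succ hw hlt hD)))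

theorem rotK_sub_modEq (i : ℕ) :
    rotK n m w k0 i - k0 ≡ (n : ℤ) * ((w.take i).count Rl : ℕ) [ZMOD (m : ℤ)] := by
  rw [Int.modEq_iff_dvd]
  exact ⟨(w.take i).count Dl, by rw [rotK]; ring⟩

theorem count_take_lt (hw : IsWord n m w) (hlast : ∃ x, w = x ++ [Rl]) {i : ℕ}
    (hi : i < m + n) : (w.take i).count Rl < m := by
  obtain ⟨x, rfl⟩ := hlast
  obtain ⟨hl, hc⟩ := hw
  simp only [List.length_append, List.length_singleton] at hl
  rw [List.take_append_of_le_length (by lia)]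
  have := (List.take_sublist i x).count_le Rl
  simp only [List.count_append, List.count_singleton_self] at hc
  lia

theorem mem_Ejset_iff (hco : Nat.Coprime n m) (hw : IsWord n m w)
    (hlast : ∃ x, w = x ++ [Rl]) {j : ℕ} (hj : j < m) {p : List Bool × ℤ} :
    p ∈ Ejset n m w k0 j ↔
      ∃ i < m + n, (w.take i).count Rl = j ∧ p = (rotWord w i, rotK n m w k0 i) := by
  refine exists_congr fun i ↦ and_congr_right fun hi ↦ and_congr_left fun _ ↦ ?_
  constructor
  · intro h
    have h' : n * (w.take i).count Rl ≡ n * j [MOD m] := by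
      rw [← Int.natCast_modEq_iff]
      exact_mod_cast (rotK_sub_modEq i).symm.trans h
    exact (h'.cancel_left_of_coprime hco.symm).eq_of_lt_of_lt (count_take_lt hw hlast hi) hj
  · rintro rfl
    exact rotK_sub_modEq i

theorem WRelRow.mem_Ejset_iff (hco : Nat.Coprime n m) (hw : IsWord n m w)
    (hlast : ∃ x, w = x ++ [Rl]) {j : ℕ} (hj : j < m) {p q : List Bool × ℤ}
    (h : WRelRow n m p q) : p ∈ Ejset n m w k0 j ↔ q ∈ Ejset n m w k0 j := by
  rw [_root_.mem_Ejset_iff hco hw hlast hj, _root_.mem_Ejset_iff hco hw hlast hj]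
  obtain ⟨x, k, -⟩ := h
  constructor
  · rintro ⟨i, hi, hc, hp⟩
    obtain ⟨hx, rfl⟩ := Prod.mk.inj hp
    cases i with
    | zero =>
      obtain ⟨y, rfl⟩ := hlast
      simp [rotWord, Rl, Dl] at hx
    | succ i =>
      have hi' : i < w.length := by rw [hw.1]; lia
      rw [rotWord_succ hi'] at hx
      obtain ⟨rfl, hD⟩ := List.append_inj' hx rfl
      have hD : w[i] = Dl := by simpa using hD.symm
      refine ⟨i, by lia, by rw [← hc, count_take_succ_of_eq_Dl hi' hD], ?_⟩
      rw [rotWord_eq_cons hi', hD, rotK_succ_of_eq_Dl hi' hD]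
  · rintro ⟨i, hi, hc, hp⟩
    obtain ⟨hx, hk⟩ := Prod.mk.inj hp
    have hi' : i < w.length := by rw [hw.1]; lia
    rw [rotWord_eq_cons hi'] at hx
    obtain ⟨hD, rfl⟩ := List.cons.inj hx
    have hne : i + 1 ≠ m + n := by
      intro he
      have hlen := hw.1
      obtain ⟨y, rfl⟩ := hlast
      simp only [List.length_append, List.length_singleton] at hlen
      obtain rfl : i = y.length := by lia
      simp [Rl, Dl] at hD
    refine ⟨i + 1, by lia, by rw [← hc, count_take_succ_of_eq_Dl hi' hD.symm], ?_⟩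
    have := rotK_succ_of_eq_Dl (n := n) (m := m) (k0 := k0) hi' hD.symm
    rw [rotWord_succ hi', ← hD, Prod.mk.injEq]
    exact ⟨rfl, by lia⟩

end

/-- Theorem 3.14 of the paper. Suppose `m, n` are coprime and the last
letter of `w_0` is `R`.  Then each `E_j` (for `0 ≤ j < m`) is nonempty,
`E = E_0 ∪ ⋯ ∪ E_{m-1}`, and the sets `E_0, …, E_{m-1}` are precisely the
`≈`-equivalence classes of the elements of `E`. -/
theorem Ej_decomposition (n m : ℕ) (hn : 0 < n) (hm : 0 < m)
    (hco : Nat.Coprime n m) (w0 : List Bool) (hw : IsWord n m w0)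
    (hlast : ∃ x, w0 = x ++ [Rl]) (k0 : ℤ) :
    (∀ j < m, (Ejset n m w0 k0 j).Nonempty) ∧
    (Eset n m w0 k0 = ⋃ j ∈ Finset.range m, Ejset n m w0 k0 j) ∧
    (∀ j < m, ∀ p ∈ Ejset n m w0 k0 j,
      {q | Relation.EqvGen (WRelRow n m) p q} = Ejset n m w0 k0 j) := by
  have hmem {j : ℕ} (hj : j < m) {p : List Bool × ℤ} :=
    mem_Ejset_iff (k0 := k0) (p := p) hco hw hlast hj
  refine ⟨fun j hj ↦ ?_, ?_, fun j hj p hp ↦ ?_⟩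
  · obtain ⟨t, ht, rfl⟩ := exists_count_take_eq Rl (j := j) le_rfl
      (by rw [List.take_length, hw.2]; exact hj.le)
    rcases ht.lt_or_eq with ht | rfl
    · exact ⟨_, (hmem hj).2 ⟨t, hw.1 ▸ ht, rfl, rfl⟩⟩
    · rw [List.take_length, hw.2] at hj
      exact absurd hj (lt_irrefl m)
  · ext p
    simp only [Set.mem_iUnion, Finset.mem_range, exists_prop]
    constructor
    · rintro ⟨i, hi, rfl⟩
      have hlt := count_take_lt hw hlast hi
      exact ⟨_, hlt, (hmem hlt).2 ⟨i, hi, rfl, rfl⟩⟩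
    · rintro ⟨j, -, i, hi, -, rfl⟩
      exact ⟨i, hi, rfl⟩
  · ext q
    constructor
    · intro h
      have hiff : p ∈ Ejset n m w0 k0 j ↔ q ∈ Ejset n m w0 k0 j := by
        clear hp
        induction (h : Relation.EqvGen (WRelRow n m) p q) with
        | rel _ _ h => exact h.mem_Ejset_iff hco hw hlast hj
        | refl => rfl
        | symm _ _ _ ih => exact ih.symm
        | trans _ _ _ _ _ ih₁ ih₂ => exact ih₁.trans ih₂
      exact hiff.1 hp
    · intro hq
      obtain ⟨i, hi, hc, rfl⟩ := (hmem hj).1 hp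
      obtain ⟨i', hi', hc', rfl⟩ := (hmem hj).1 hq
      have hlen := hw.1
      rcases le_total i i' with h | h
      · exact eqvGen_rot_of_count_eq hlen h (by lia) (by lia)
      · exact .symm _ _ (eqvGen_rot_of_count_eq hlen h (by lia) (by lia))
end

section
/- Let n, m be coprime positive integers, w_0 ∈ 𝒲 a word, k_0 ∈ ℤ, and E = {(w_i, k_i) : 0 ≤ i < m+n}. Then: (a) there exists i with 0 ≤ i < m+n such that m divides k_i; (b) the set {(w_i, k_i) ∈ E : m divides k_i} is a single ≈-equivalence class. -/
theorem rotK_succ_of_D {n m : ℕ} {w : List Bool} {k0 : ℤ} {i : ℕ} (hi : i < w.length)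
    (hD : w[i] = Dl) : rotK n m w k0 i = rotK n m w k0 (i + 1) + m := by
  simp only [rotK, ← List.take_append_getElem hi, hD, List.count_append]
  simp [Rl, Dl]
  ring

theorem count_R_take_succ {w : List Bool} {i : ℕ} (hi : i < w.length) :
    (w.take (i + 1)).count Rl = (w.take i).count Rl + if w[i] = Dl then 0 else 1 := by
  rw [← List.take_append_getElem hi, List.count_append]
  cases h : w[i] <;> simp [Rl, Dl]

theorem count_R_take_mono (w : List Bool) {i j : ℕ} (hij : i ≤ j) :
    (w.take i).count Rl ≤ (w.take j).count Rl :=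
  ((List.take_prefix_take_left hij).sublist).count_le _

theorem rotK_length {n m : ℕ} {w : List Bool} (hw : IsWord n m w) (k0 : ℤ) :
    rotK n m w k0 (m + n) = k0 := by
  have hD : w.count Dl = n := by
    have h := List.count_true_add_count_false w
    have h1 := hw.1
    have h2 := hw.2
    simp only [Rl, Dl] at *
    omega
  rw [rotK, ← hw.1, List.take_length, hw.2, hD]
  ring

theorem rotWord_length {n m : ℕ} {w : List Bool} (hw : IsWord n m w) :
    rotWord w (m + n) = w := by
  simp [rotWord, ← hw.1]

/-- The pair `(w_i, k_i)`. -/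
def rotPair (n m : ℕ) (w : List Bool) (k0 : ℤ) (i : ℕ) : List Bool × ℤ :=
  (rotWord w i, rotK n m w k0 i)

theorem rotPair_length {n m : ℕ} {w : List Bool} (hw : IsWord n m w) (k0 : ℤ) :
    rotPair n m w k0 (m + n) = rotPair n m w k0 0 := by
  rw [rotPair, rotWord_length hw, rotK_length hw]
  simp [rotPair, rotWord, rotK]

theorem wRelRow_rotPair_succ {n m : ℕ} {w : List Bool} (hw : w.length = m + n) (k0 : ℤ) {i : ℕ}
    (hi : i < w.length) (hD : w[i] = Dl) :
    WRelRow n m (rotPair n m w k0 (i + 1)) (rotPair n m w k0 i) := by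
  rw [rotPair, rotPair, rotWord_succ hi, rotWord_eq_cons hi, rotK_succ_of_D hi hD, hD]
  refine .row _ _ ?_
  simp only [List.length_append, List.length_drop, List.length_take]
  omega

theorem eq_rotPair_succ_of_wRelRow {n m : ℕ} {w : List Bool} {k0 : ℤ} {i : ℕ}
    (hi : i < w.length) {p : List Bool × ℤ} (h : WRelRow n m p (rotPair n m w k0 i)) :
    p = rotPair n m w k0 (i + 1) ∧ rotK n m w k0 i = rotK n m w k0 (i + 1) + m := by
  generalize hq : rotPair n m w k0 i = q at h
  obtain ⟨x, k, -⟩ := h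
  simp only [rotPair, rotWord_eq_cons hi, Prod.mk.injEq, List.cons.injEq] at hq
  obtain ⟨⟨hD, hx⟩, hk⟩ := hq
  have hs := rotK_succ_of_D (n := n) (m := m) (k0 := k0) hi hD
  refine ⟨?_, hs⟩
  rw [rotPair, rotWord_succ hi, hD, hx, Prod.mk.injEq]
  exact ⟨rfl, by linarith⟩

theorem eq_rotPair_of_wRelRow_succ {n m : ℕ} {w : List Bool} {k0 : ℤ} {i : ℕ}
    (hi : i < w.length) {q : List Bool × ℤ} (h : WRelRow n m (rotPair n m w k0 (i + 1)) q) :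
    q = rotPair n m w k0 i ∧ rotK n m w k0 i = rotK n m w k0 (i + 1) + m := by
  generalize hp : rotPair n m w k0 (i + 1) = p at h
  obtain ⟨x, k, -⟩ := h
  simp only [rotPair, rotWord_succ hi, Prod.mk.injEq] at hp
  obtain ⟨hx, hk⟩ := hp
  obtain ⟨hx, hD⟩ := List.append_inj' hx rfl
  simp only [List.cons.injEq, and_true] at hD
  have hs := rotK_succ_of_D (n := n) (m := m) (k0 := k0) hi hD
  refine ⟨?_, hs⟩
  rw [rotPair, rotWord_eq_cons hi, hD, hx, Prod.mk.injEq]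
  exact ⟨rfl, by linarith⟩

theorem eqvGen_rotPair_of_count_eq {n m : ℕ} {w : List Bool} (hw : w.length = m + n) (k0 : ℤ)
    {i j : ℕ} (hij : i ≤ j) (hj : j ≤ w.length)
    (hc : (w.take i).count Rl = (w.take j).count Rl) :
    Relation.EqvGen (WRelRow n m) (rotPair n m w k0 i) (rotPair n m w k0 j) := by
  induction j, hij using Nat.le_induction with
  | base => exact .refl _
  | succ j hij ih =>
    have hle := count_R_take_mono w hij
    have hs := count_R_take_succ (w := w) (i := j) hj
    by_cases hD : w[j] = Dl
    · rw [if_pos hD] at hs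
      exact .trans _ _ _ (ih (by omega) (by omega))
        (.symm _ _ (.rel _ _ (wRelRow_rotPair_succ hw k0 hj hD)))
    · rw [if_neg hD] at hs
      omega

theorem exists_count_R_take_eq (w : List Bool) {r : ℕ} (hr : r < w.count Rl) :
    ∃ i < w.length, (w.take i).count Rl = r := by
  classical
  have hex : ∃ i, r < (w.take i).count Rl := ⟨w.length, by simpa using hr⟩
  obtain ⟨i, hi, hmin⟩ : ∃ i, r < (w.take i).count Rl ∧
      ∀ j < i, ¬ r < (w.take j).count Rl :=
    ⟨Nat.find hex, Nat.find_spec hex, fun j => Nat.find_min hex⟩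
  obtain _ | i := i
  · simp at hi
  have hlt : i < w.length := by
    by_contra! hle
    apply hmin i i.lt_succ_self
    rwa [List.take_of_length_le hle]
  have hs := count_R_take_succ hlt
  have := hmin i i.lt_succ_self
  refine ⟨i, hlt, ?_⟩
  split_ifs at hs <;> omega

theorem dvd_rotK_iff {n m : ℕ} {w : List Bool} {k0 : ℤ} {i : ℕ} :
    (m : ℤ) ∣ rotK n m w k0 i ↔ (m : ℤ) ∣ k0 + n * ((w.take i).count Rl : ℤ) :=
  dvd_sub_left (dvd_mul_right _ _)

theorem exists_lt_dvd_add_mul {n m : ℕ} (hm : 0 < m) (hco : Nat.Coprime n m) (k : ℤ) :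
    ∃ r < m, (m : ℤ) ∣ k + n * (r : ℤ) := by
  have hm' : (0 : ℤ) < m := by exact_mod_cast hm
  obtain ⟨a, b, hab⟩ : IsCoprime (n : ℤ) m := Nat.isCoprime_iff_coprime.2 hco
  have h0 := Int.emod_nonneg (-k * a) hm'.ne'
  have h1 := Int.emod_lt_of_pos (-k * a) hm'
  refine ⟨((-k * a) % m).toNat, by omega, ?_⟩
  rw [Int.toNat_of_nonneg h0, Int.emod_def]
  exact ⟨k * b - n * (-k * a / m), by linear_combination (-k) * hab⟩

theorem dvd_count_R_take_sub {n m : ℕ} (hco : Nat.Coprime n m) {w : List Bool} {k0 : ℤ} {i j : ℕ}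
    (hi : (m : ℤ) ∣ rotK n m w k0 i) (hj : (m : ℤ) ∣ rotK n m w k0 j) :
    (m : ℤ) ∣ ((w.take j).count Rl : ℤ) - ((w.take i).count Rl : ℤ) := by
  have h := dvd_sub (dvd_rotK_iff.1 hj) (dvd_rotK_iff.1 hi)
  rw [add_sub_add_left_eq_sub, ← mul_sub] at h
  exact (Nat.isCoprime_iff_coprime.2 hco.symm).dvd_of_dvd_mul_left h

theorem eqvGen_rotPair_of_le {n m : ℕ} (hco : Nat.Coprime n m) {w : List Bool}
    (hw : IsWord n m w) {k0 : ℤ} {i j : ℕ} (hij : i ≤ j) (hj : j < m + n)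
    (hki : (m : ℤ) ∣ rotK n m w k0 i) (hkj : (m : ℤ) ∣ rotK n m w k0 j) :
    Relation.EqvGen (WRelRow n m) (rotPair n m w k0 i) (rotPair n m w k0 j) := by
  have hdvd := dvd_count_R_take_sub hco hki hkj
  have hlen := hw.1
  have hle := count_R_take_mono w hij
  have hfull : (w.take (m + n)).count Rl = m := by rw [← hw.1, List.take_length, hw.2]
  have hjm := count_R_take_mono w hj.le
  by_cases hc : (w.take i).count Rl = (w.take j).count Rl
  · exact eqvGen_rotPair_of_count_eq hlen k0 hij (by omega) hc
  have hm : m ≤ (w.take j).count Rl - (w.take i).count Rl := by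
    refine Nat.le_of_dvd (by omega) ?_
    rw [← Nat.cast_sub hle] at hdvd
    exact_mod_cast hdvd
  have h0 := eqvGen_rotPair_of_count_eq hlen k0 (zero_le (a := i)) (by omega)
    (by simp only [List.take_zero, List.count_nil]; omega)
  have h1 := eqvGen_rotPair_of_count_eq hlen k0 hj.le (by omega) (by omega)
  rw [rotPair_length hw] at h1
  exact .symm _ _ (.trans _ _ _ h1 h0)

/-- The pairs `(w_i, k_i)` of `E` with `m ∣ k_i`. -/
def dvdPairs (n m : ℕ) (w : List Bool) (k0 : ℤ) : Set (List Bool × ℤ) :=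
  {p | ∃ i < m + n, p = (rotWord w i, rotK n m w k0 i) ∧ (m : ℤ) ∣ rotK n m w k0 i}

theorem rotPair_mem_dvdPairs {n m : ℕ} (hm : 0 < m) {w : List Bool} (hw : IsWord n m w) {k0 : ℤ}
    {i : ℕ} (hi : i ≤ m + n) (hk : (m : ℤ) ∣ rotK n m w k0 i) :
    rotPair n m w k0 i ∈ dvdPairs n m w k0 := by
  obtain hi | rfl := hi.lt_or_eq
  · exact ⟨i, hi, rfl, hk⟩
  · have h := rotPair_length hw k0
    have hK : rotK n m w k0 (m + n) = rotK n m w k0 0 := congrArg Prod.snd h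
    exact ⟨0, by omega, h, hK ▸ hk⟩

theorem wRelRow_mem_dvdPairs_iff {n m : ℕ} (hm : 0 < m) {w : List Bool} (hw : IsWord n m w)
    {k0 : ℤ} {p q : List Bool × ℤ} (h : WRelRow n m p q) :
    p ∈ dvdPairs n m w k0 ↔ q ∈ dvdPairs n m w k0 := by
  have hlen := hw.1
  constructor
  · rintro ⟨i, hi, rfl, hk⟩
    obtain ⟨j, hj, hij⟩ : ∃ j < m + n, rotPair n m w k0 i = rotPair n m w k0 (j + 1) := by
      obtain _ | i := i
      · refine ⟨m + n - 1, by omega, ?_⟩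
        rw [Nat.sub_add_cancel (by omega), rotPair_length hw]
      · exact ⟨i, by omega, rfl⟩
    change WRelRow n m (rotPair n m w k0 i) q at h
    rw [hij] at h
    obtain ⟨rfl, hs⟩ := eq_rotPair_of_wRelRow_succ (by omega) h
    refine rotPair_mem_dvdPairs hm hw hj.le ?_
    have hK : rotK n m w k0 i = rotK n m w k0 (j + 1) := congrArg Prod.snd hij
    rw [hs, ← hK]
    exact dvd_add hk dvd_rfl
  · rintro ⟨i, hi, rfl, hk⟩
    obtain ⟨rfl, hs⟩ := eq_rotPair_succ_of_wRelRow (by omega) h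
    refine rotPair_mem_dvdPairs hm hw (by omega) ?_
    rw [hs] at hk
    exact (dvd_add_left dvd_rfl).1 hk

theorem eqvGen_mem_dvdPairs_iff {n m : ℕ} (hm : 0 < m) {w : List Bool} (hw : IsWord n m w)
    {k0 : ℤ} {p q : List Bool × ℤ} (h : Relation.EqvGen (WRelRow n m) p q) :
    p ∈ dvdPairs n m w k0 ↔ q ∈ dvdPairs n m w k0 := by
  induction h with
  | rel _ _ h => exact wRelRow_mem_dvdPairs_iff hm hw h
  | refl => rfl
  | symm _ _ _ ih => exact ih.symm
  | trans _ _ _ _ _ ih₁ ih₂ => exact ih₁.trans ih₂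

/-- Lemma 3.15(a),(b) of the paper. Suppose `m, n` are coprime.
(a) There exists `i` with `0 ≤ i < m+n` such that `m` divides `k_i`.
(b) The set of elements `(w_i, k_i)` of `E` with `m ∣ k_i` forms a single
`≈`-equivalence class. -/
theorem rep_div_m_exists_and_single_class (n m : ℕ) (hn : 0 < n) (hm : 0 < m)
    (hco : Nat.Coprime n m) (w0 : List Bool) (hw : IsWord n m w0) (k0 : ℤ) :
    (∃ i < m + n, (m : ℤ) ∣ rotK n m w0 k0 i) ∧
    (∀ p ∈ {p : List Bool × ℤ | ∃ i < m + n,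
        p = (rotWord w0 i, rotK n m w0 k0 i) ∧ (m : ℤ) ∣ rotK n m w0 k0 i},
      {q | Relation.EqvGen (WRelRow n m) p q} =
        {p : List Bool × ℤ | ∃ i < m + n,
          p = (rotWord w0 i, rotK n m w0 k0 i) ∧ (m : ℤ) ∣ rotK n m w0 k0 i}) := by
  refine ⟨?_, fun p hp => Set.ext fun q => ⟨fun h => (eqvGen_mem_dvdPairs_iff hm hw h).1 hp, ?_⟩⟩
  · obtain ⟨r, hr, hdvd⟩ := exists_lt_dvd_add_mul hm hco k0
    obtain ⟨i, hi, rfl⟩ := exists_count_R_take_eq w0 (hw.2.symm ▸ hr)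
    exact ⟨i, hw.1 ▸ hi, dvd_rotK_iff.2 hdvd⟩
  · obtain ⟨i, hi, rfl, hki⟩ := hp
    rintro ⟨j, hj, rfl, hkj⟩
    obtain hij | hji := le_total i j
    · exact eqvGen_rotPair_of_le hco hw hij hj hki hkj
    · exact .symm _ _ (eqvGen_rotPair_of_le hco hw hji hi hkj hki)
end
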